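/- arXiv:1909.12370 — 2 statements merged into one kernel-verified Lean document; each statement's English description precedes it below -/
import Mathlib

section
/- Consider the region swap game with n = 6, k = 8, where the coordinates of (ZMod 2)^6 are indexed by the six edges of the complete graph K4 on vertices {1,2,3,4} (in the order e1 = {1,2}, e2 = {1,3}, e3 = {1,4}, e4 = {2,3}, e5 = {2,4}, e6 = {3,4}), the eight move vectors are the four star vectors S_v (for v ∈ {1,2,3,4}, S_v is the indicator vector of the three edges incident to v) and the four triangle vectors T_v (for v ∈ {1,2,3,4}, T_v is the indicator vector of the three edges joining the vertices of {1,2,3,4} \ {v}), and the winning set W is the set of indicator vectors of edge sets of spanning trees of K4. Then for every initial state V0 ∈ W, Player C moving second has a winning strategy. -/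
/-- Winning positions for Player C in the region swap game with move vectors
`r : Fin k → Fin n → ZMod 2` and winning set `W`.  The first argument is the number of
turns remaining, `used` is the set of indices already selected, the next argument is the
current state, and the `Bool` records whether it is Player C's turn to move
(`true` = C to move).  On each turn the player to move selects an unused index `i`
together with a value `ε : ZMod 2`, changing the state by `ε • r i`.  When no turns
remain, Player C has won exactly if the final state lies in `W`. -/
def CWins {k n : ℕ} (r : Fin k → Fin n → ZMod 2) (W : Set (Fin n → ZMod 2)) :
    ℕ → Finset (Fin k) → (Fin n → ZMod 2) → Bool → Prop
  | 0, _, v, _ => v ∈ W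
  | m + 1, used, v, true => ∃ i : Fin k, i ∉ used ∧ ∃ ε : ZMod 2,
      CWins r W m (insert i used) (v + ε • r i) false
  | m + 1, used, v, false => ∀ i : Fin k, i ∉ used → ∀ ε : ZMod 2,
      CWins r W m (insert i used) (v + ε • r i) true

/-- The endpoints of the six edges of `K4` on the vertex set `Fin 4`, in the order
`e1 = {1,2}`, `e2 = {1,3}`, `e3 = {1,4}`, `e4 = {2,3}`, `e5 = {2,4}`, `e6 = {3,4}`
(vertices renamed `0,1,2,3`). -/
def k4Ends : Fin 6 → Fin 4 × Fin 4 := ![(0, 1), (0, 2), (0, 3), (1, 2), (1, 3), (2, 3)]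

/-- The star vector `S_v`: the indicator vector of the three edges of `K4` incident to
the vertex `v`. -/
def starVec (v : Fin 4) : Fin 6 → ZMod 2 :=
  fun j => if (k4Ends j).1 = v ∨ (k4Ends j).2 = v then 1 else 0

/-- The triangle vector `T_v`: the indicator vector of the three edges of `K4` joining
the vertices other than `v`. -/
def triVec (v : Fin 4) : Fin 6 → ZMod 2 :=
  fun j => if (k4Ends j).1 ≠ v ∧ (k4Ends j).2 ≠ v then 1 else 0

/-- The eight region move vectors of the Borromean rings game board: the four star
vectors and the four triangle vectors. -/
def borromeanMoves : Fin 8 → Fin 6 → ZMod 2 :=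
  ![starVec 0, starVec 1, starVec 2, starVec 3, triVec 0, triVec 1, triVec 2, triVec 3]

/-- The simple graph on `Fin 4` whose edge set consists of the edges of `K4` indicated
by the vector `v`. -/
def k4Graph (v : Fin 6 → ZMod 2) : SimpleGraph (Fin 4) :=
  SimpleGraph.fromRel fun x y => ∃ i : Fin 6, v i = 1 ∧ k4Ends i = (x, y)

/-- The winning set: indicator vectors of edge sets of spanning trees of `K4`. -/
def borromeanW : Set (Fin 6 → ZMod 2) := {v | (k4Graph v).IsTree}

/-- A pairing strategy: Player C answers each move `ε • r i` with `ε • r (σ i)`, where `σ` is a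
fixed-point-free involution of the indices.  It keeps the state inside any set `Q` that is
stable under the translations by `r i + r (σ i)`. -/
theorem CWins_of_pairing {k n : ℕ} {r : Fin k → Fin n → ZMod 2} {W : Set (Fin n → ZMod 2)}
    (σ : Fin k → Fin k) (hσ : Function.Involutive σ) (hfix : ∀ i, σ i ≠ i)
    {Q : Set (Fin n → ZMod 2)} (hQW : Q ⊆ W) (hQ : ∀ v ∈ Q, ∀ i, v + (r i + r (σ i)) ∈ Q)
    (m : ℕ) (used : Finset (Fin k)) (hused : ∀ i, σ i ∈ used → i ∈ used)
    (v : Fin n → ZMod 2) (hv : v ∈ Q) : CWins r W (2 * m) used v false := by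
  induction m generalizing used v with
  | zero => exact hQW hv
  | succ m ih =>
    intro i hi ε
    refine ⟨σ i, ?_, ε, ih _ ?_ _ ?_⟩
    · simpa [hfix i] using fun h => hi (hused i h)
    · intro j hj
      simp only [Finset.mem_insert] at hj ⊢
      rcases hj with hj | hj | hj
      · exact .inr (.inl (hσ.injective hj))
      · exact .inl (by rw [← hj, hσ j])
      · exact .inr (.inr (hused j hj))
    · rw [add_assoc, ← smul_add]
      have hε : ε = 0 ∨ ε = 1 := by revert ε; decide
      rcases hε with rfl | rfl
      · simpa using hv
      · simpa using hQ v hv i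

instance (v : Fin 6 → ZMod 2) : DecidableRel (k4Graph v).Adj := fun x y =>
  inferInstanceAs (Decidable (x ≠ y ∧
    ((∃ i, v i = 1 ∧ k4Ends i = (x, y)) ∨ ∃ i, v i = 1 ∧ k4Ends i = (y, x))))

theorem mem_borromeanW_iff (v : Fin 6 → ZMod 2) :
    v ∈ borromeanW ↔ (k4Graph v).Connected ∧ (k4Graph v).edgeFinset.card + 1 = 4 := by
  change (k4Graph v).IsTree ↔ _
  rw [SimpleGraph.isTree_iff_connected_and_card, Nat.card_eq_fintype_card,
    ← SimpleGraph.edgeFinset_card, Nat.card_eq_fintype_card, Fintype.card_fin]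

theorem starVec_mem_borromeanW (u : Fin 4) : starVec u ∈ borromeanW := by
  rw [mem_borromeanW_iff]
  revert u
  decide +kernel

/-- A spanning tree of `K4` is a star or a path, and the complement of a path is a path. -/
theorem eq_starVec_or_add_one_mem {v : Fin 6 → ZMod 2} (hv : v ∈ borromeanW) :
    (∃ u, v = starVec u) ∨ v + 1 ∈ borromeanW := by
  rw [mem_borromeanW_iff] at hv ⊢
  revert v
  decide +kernel

/-- On the Borromean rings game board (the checkerboard graph `K4`), for every initial
state that is a spanning tree of `K4`, Player C moving second has a winning strategy in
the region swap game. -/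
theorem stmt_5 : ∀ V0 ∈ borromeanW, CWins borromeanMoves borromeanW 8 ∅ V0 false := by
  intro V0 hV0
  rcases eq_starVec_or_add_one_mem hV0 with ⟨u, rfl⟩ | hV1
  · refine CWins_of_pairing (Q := Set.range starVec) ![1, 0, 3, 2, 5, 4, 7, 6]
      (by unfold Function.Involutive; decide) (by decide) ?_ ?_ 4 ∅ (by simp) _ ⟨u, rfl⟩
    · rintro _ ⟨u, rfl⟩
      exact starVec_mem_borromeanW u
    · rintro _ ⟨u, rfl⟩ i
      simp only [Set.mem_range]
      revert u i
      decide +kernel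
  · have hsum : ∀ i, borromeanMoves i + borromeanMoves (i + 4) = 1 := by decide +kernel
    refine CWins_of_pairing (Q := {v | v ∈ borromeanW ∧ v + 1 ∈ borromeanW}) (· + 4)
      (by unfold Function.Involutive; decide) (by decide) (fun _ h => h.1) ?_ 4 ∅ (by simp) _
      ⟨hV0, hV1⟩
    rintro v ⟨h0, h1⟩ i
    have h2 : v + 1 + 1 = v := by rw [add_assoc, CharTwo.add_self_eq_zero, add_zero]
    rw [hsum]
    exact ⟨h1, h2.symm ▸ h0⟩
end

section
/- (Nash-Williams, Tutte) Let G be a finite simple graph with nonempty vertex set and let k be a positive natural number. Then G contains k pairwise edge-disjoint spanning trees if and only if for every partition P of the vertex set of G, the number of edges of G whose two endpoints lie in different parts of P is at least k·(|P| − 1), where |P| is the number of parts of P. -/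
namespace SimpleGraph

variable {V : Type*}

lemma Reachable.of_adj_reachable {G H : SimpleGraph V} {u v : V} (h : G.Reachable u v)
    (hGH : ∀ ⦃a b⦄, G.Adj a b → H.Reachable a b) : H.Reachable u v := by
  obtain ⟨p⟩ := h
  induction p with
  | nil => exact .refl _
  | cons hadj _ ih => exact (hGH hadj).trans ih

lemma reachable_sup_edge_cases {H : SimpleGraph V} {u v a b : V}
    (h : (H ⊔ edge u v).Reachable a b) :
    H.Reachable a b ∨ (H.Reachable a u ∧ H.Reachable v b) ∨
      (H.Reachable a v ∧ H.Reachable u b) := by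
  obtain ⟨p⟩ := h
  induction p with
  | nil => exact .inl (.refl _)
  | @cons a c b hadj _ ih =>
    rw [sup_adj, edge_adj] at hadj
    rcases hadj with hadj | ⟨⟨rfl, rfl⟩ | ⟨rfl, rfl⟩, -⟩
    · have hac := hadj.reachable
      rcases ih with h | ⟨h, h'⟩ | ⟨h, h'⟩
      · exact .inl (hac.trans h)
      · exact .inr (.inl ⟨hac.trans h, h'⟩)
      · exact .inr (.inr ⟨hac.trans h, h'⟩)
    · rcases ih with h | ⟨h, h'⟩ | ⟨h, h'⟩
      · exact .inr (.inl ⟨.refl _, h⟩)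
      · exact .inr (.inl ⟨.refl _, h'⟩)
      · exact .inl h'
    · rcases ih with h | ⟨h, h'⟩ | ⟨h, h'⟩
      · exact .inr (.inr ⟨.refl _, h⟩)
      · exact .inl h'
      · exact .inr (.inr ⟨.refl _, h'⟩)

lemma card_connectedComponent_sup_edge_add_one [Finite V] {H : SimpleGraph V} {u v : V}
    (huv : ¬ H.Reachable u v) :
    Nat.card (H ⊔ edge u v).ConnectedComponent + 1 = Nat.card H.ConnectedComponent := by
  classical
  have := Fintype.ofFinite H.ConnectedComponent
  have hne : u ≠ v := fun h ↦ huv (h ▸ .refl _)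
  have hadj : (H ⊔ edge u v).Adj u v := by simp [edge_adj, hne]
  have hle : H ≤ H ⊔ edge u v := le_sup_left
  let f : {c : H.ConnectedComponent // c ≠ H.connectedComponentMk v} →
      (H ⊔ edge u v).ConnectedComponent := fun c ↦ c.1.map (Hom.ofLE hle)
  have hf : Function.Bijective f := by
    constructor
    · rintro ⟨c, hc⟩ ⟨d, hd⟩ hcd
      induction c using ConnectedComponent.ind with | _ a
      induction d using ConnectedComponent.ind with | _ b
      have hab : (H ⊔ edge u v).Reachable a b := ConnectedComponent.exact hcd
      refine Subtype.ext (ConnectedComponent.sound ?_)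
      rcases reachable_sup_edge_cases hab with h | ⟨-, h⟩ | ⟨h, -⟩
      · exact h
      · exact absurd (ConnectedComponent.sound h.symm) hd
      · exact absurd (ConnectedComponent.sound h) hc
    · intro c
      induction c using ConnectedComponent.ind with | _ a
      by_cases ha : H.Reachable a v
      · exact ⟨⟨H.connectedComponentMk u, fun h ↦ huv (ConnectedComponent.exact h)⟩,
          ConnectedComponent.sound (hadj.reachable.trans (ha.mono hle).symm)⟩
      · exact ⟨⟨H.connectedComponentMk a, fun h ↦ ha (ConnectedComponent.exact h)⟩, rfl⟩
  rw [← Nat.card_eq_of_bijective f hf, Nat.card_eq_fintype_card, Nat.card_eq_fintype_card,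
    Fintype.card_subtype_compl, Fintype.card_subtype_eq]
  have : 0 < Fintype.card H.ConnectedComponent :=
    Fintype.card_pos_iff.mpr ⟨H.connectedComponentMk v⟩
  omega

lemma deleteEdges_singleton_sup_edge {H : SimpleGraph V} {a b : V} (hab : H.Adj a b) :
    H.deleteEdges {s(a, b)} ⊔ edge a b = H := by
  rw [← edgeSet_inj, edgeSet_sup, edgeSet_deleteEdges, edgeSet_edge_of_ne hab.ne]
  exact Set.sdiff_union_of_subset (by simpa using hab)

lemma IsAcyclic.ncard_edgeSet_add_card_connectedComponent [Finite V] {H : SimpleGraph V}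
    (hH : H.IsAcyclic) :
    H.edgeSet.ncard + Nat.card H.ConnectedComponent = Nat.card V := by
  induction hn : H.edgeSet.ncard generalizing H with
  | zero =>
    have : H = ⊥ := by
      rwa [Set.ncard_eq_zero, edgeSet_eq_empty] at hn
    subst this
    rw [zero_add]
    refine (Nat.card_eq_of_bijective (connectedComponentMk ⊥)
      ⟨fun a b h ↦ ?_, Quot.mk_surjective⟩).symm
    simpa using ConnectedComponent.exact h
  | succ n ih =>
    obtain ⟨e, he⟩ : H.edgeSet.Nonempty := by
      rw [← Set.ncard_pos]; omega
    induction e using Sym2.ind with | _ a b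
    have hab : H.Adj a b := he
    have hbr : ¬ (H.deleteEdges {s(a, b)}).Reachable a b := by
      simpa [isBridge_iff, deleteEdges] using isAcyclic_iff_forall_adj_isBridge.mp hH hab
    have hcard := card_connectedComponent_sup_edge_add_one hbr
    rw [deleteEdges_singleton_sup_edge hab] at hcard
    have := ih (H := H.deleteEdges {s(a, b)}) (hH.anti (deleteEdges_le _)) (by
      rw [edgeSet_deleteEdges, Set.ncard_sdiff_singleton_of_mem he, hn]; rfl)
    omega

lemma IsAcyclic.isTree_of_card_connectedComponent_le_one [Nonempty V] {H : SimpleGraph V}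
    [Finite V] (hH : H.IsAcyclic) (hc : Nat.card H.ConnectedComponent ≤ 1) : H.IsTree := by
  have := Finite.card_le_one_iff_subsingleton.mp hc
  exact ⟨⟨fun u v ↦ ConnectedComponent.exact (Subsingleton.elim _ _)⟩, hH⟩

/-- In a forest, an edge on the path between `x` and `y` can be exchanged for the edge `xy`. -/
lemma IsAcyclic.deleteEdges_sup_edge {H : SimpleGraph V} (hH : H.IsAcyclic) {x y : V}
    {p : H.Walk x y} (hp : p.IsPath) {f : Sym2 V} (hf : f ∈ p.edges) :
    (H.deleteEdges {f} ⊔ edge x y).IsAcyclic := by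
  refine (hH.anti (deleteEdges_le _)).sup_edge_of_not_reachable fun hr ↦ ?_
  obtain ⟨q, hq⟩ := hr.exists_isPath
  have hpq := (hH.subsingleton_path x y).elim ⟨p, hp⟩ ⟨q.mapLe (deleteEdges_le _), hq.mapLe _⟩
  have hpq : p = q.mapLe (deleteEdges_le _) := congrArg Subtype.val hpq
  rw [hpq, Walk.edges_mapLe_eq_edges] at hf
  have := q.edges_subset_edgeSet hf
  simp [edgeSet_deleteEdges] at this

section Finpartition

variable [Fintype V] [DecidableEq V] (P : Finpartition (Finset.univ : Finset V))

lemma card_parts_le_card_connectedComponent {H : SimpleGraph V}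
    (h : ∀ ⦃u v⦄, H.Adj u v → P.part u = P.part v) :
    P.parts.card ≤ Nat.card H.ConnectedComponent := by
  have hr : ∀ u v, H.Reachable u v → P.part u = P.part v := by
    rintro u v ⟨p⟩
    induction p with
    | nil => rfl
    | cons hadj _ ih => exact (h hadj).trans ih
  let f : H.ConnectedComponent → P.parts :=
    Quot.lift (fun v ↦ ⟨P.part v, P.part_mem.mpr (Finset.mem_univ v)⟩)
      fun u v huv ↦ Subtype.ext (hr u v huv)
  have hf : Function.Surjective f := by
    rintro ⟨p, hp⟩
    obtain ⟨v, -, hv⟩ := P.part_surjOn hp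
    exact ⟨H.connectedComponentMk v, Subtype.ext hv⟩
  simpa using Nat.card_le_card_of_surjective f hf

lemma card_connectedComponent_le_card_parts {H : SimpleGraph V}
    (h : ∀ ⦃u v⦄, P.part u = P.part v → H.Reachable u v) :
    Nat.card H.ConnectedComponent ≤ P.parts.card := by
  let f : P.parts → H.ConnectedComponent := fun p ↦
    H.connectedComponentMk (P.nonempty_of_mem_parts p.2).choose
  have hf : Function.Surjective f := by
    intro c
    induction c using ConnectedComponent.ind with | _ v
    have hv : P.part v ∈ P.parts := P.part_mem.mpr (Finset.mem_univ v)
    exact ⟨⟨P.part v, hv⟩, ConnectedComponent.sound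
      (h (P.part_eq_of_mem hv (P.nonempty_of_mem_parts hv).choose_spec))⟩
  simpa using Nat.card_le_card_of_surjective f hf

lemma exists_mem_parts_forall_mem_iff_part_eq {u v : V} :
    (∃ p ∈ P.parts, ∀ w ∈ s(u, v), w ∈ p) ↔ P.part u = P.part v := by
  rw [← P.mem_part_iff_part_eq_part (Finset.mem_univ u) (Finset.mem_univ v),
    P.mem_part_iff_exists]
  simp

/-- A spanning tree has at least `|P| - 1` edges crossing a partition `P`. -/
lemma IsTree.card_parts_le_ncard_crossing_add_one {T : SimpleGraph V} (hT : T.IsTree) :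
    P.parts.card ≤ {e ∈ T.edgeSet | ¬∃ p ∈ P.parts, ∀ v ∈ e, v ∈ p}.ncard + 1 := by
  classical
  set C := {e ∈ T.edgeSet | ¬∃ p ∈ P.parts, ∀ v ∈ e, v ∈ p}
  have hC : C ⊆ T.edgeSet := fun _ h ↦ h.1
  have hcard := (hT.isAcyclic.anti
    (T.deleteEdges_le C)).ncard_edgeSet_add_card_connectedComponent
  rw [edgeSet_deleteEdges, Set.ncard_sdiff hC] at hcard
  have hle := Set.ncard_le_ncard hC
  have hT' := (isTree_iff_connected_and_card.mp hT).2
  rw [Nat.card_coe_set_eq] at hT'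
  have := card_parts_le_card_connectedComponent P (H := T.deleteEdges C) fun u v huv ↦ by
    rw [deleteEdges_adj] at huv
    by_contra hne
    exact huv.2 ⟨huv.1, (exists_mem_parts_forall_mem_iff_part_eq P).not.mpr hne⟩
  omega

end Finpartition

section ForestPacking

variable {ι : Type*} {G : SimpleGraph V} {F F' : ι → SimpleGraph V}

/-- A family of pairwise edge-disjoint forests contained in `G`. -/
structure IsForestPacking (G : SimpleGraph V) (F : ι → SimpleGraph V) : Prop where
  isAcyclic (i : ι) : (F i).IsAcyclic
  le (i : ι) : F i ≤ G
  disjoint (i j : ι) : i ≠ j → Disjoint (F i).edgeSet (F j).edgeSet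

/-- The edges of `G` that belong to no member of the family `F`. -/
def uncovered (G : SimpleGraph V) (F : ι → SimpleGraph V) : Set (Sym2 V) :=
  {e ∈ G.edgeSet | ∀ i, e ∉ (F i).edgeSet}

lemma ne_of_mem_uncovered {x y : V} (h : s(x, y) ∈ uncovered G F) : x ≠ y :=
  Adj.ne (G := G) h.1

lemma IsForestPacking.update [DecidableEq ι] (hF : IsForestPacking G F) {x y : V}
    (hxy : s(x, y) ∈ uncovered G F) {i : ι} {H : SimpleGraph V} (hH : H.IsAcyclic)
    (hle : H ≤ F i ⊔ edge x y) : IsForestPacking G (Function.update F i H) := by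
  have hdisj : ∀ j, j ≠ i → Disjoint H.edgeSet (F j).edgeSet := by
    intro j hj
    refine Set.disjoint_of_subset_left (edgeSet_mono hle) ?_
    rw [edgeSet_sup, edgeSet_edge_of_ne (ne_of_mem_uncovered hxy), Set.disjoint_union_left]
    exact ⟨hF.disjoint i j hj.symm, Set.disjoint_singleton_left.mpr (hxy.2 j)⟩
  refine ⟨fun j ↦ ?_, fun j ↦ ?_, fun j l hjl ↦ ?_⟩
  · rcases eq_or_ne j i with rfl | hj
    · simpa using hH
    · simpa [hj] using hF.isAcyclic j
  · rcases eq_or_ne j i with rfl | hj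
    · simpa using hle.trans (sup_le (hF.le j) ((edge_le_iff _).mpr (.inr hxy.1)))
    · simpa [hj] using hF.le j
  · rcases eq_or_ne j i with rfl | hj
    · simpa [hjl.symm] using hdisj l hjl.symm
    · rcases eq_or_ne l i with rfl | hl
      · simpa [hj] using (hdisj j hj).symm
      · simpa [hj, hl] using hF.disjoint j l hjl

variable [Fintype ι]

/-- A forest packing with the largest possible total number of edges. -/
structure IsMaxForestPacking (G : SimpleGraph V) (F : ι → SimpleGraph V) : Prop
    extends IsForestPacking G F where
  le_of_isForestPacking (F' : ι → SimpleGraph V) : IsForestPacking G F' →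
    ∑ i, (F' i).edgeSet.ncard ≤ ∑ i, (F i).edgeSet.ncard

/-- `F'` is a maximum forest packing arising from `F` by adding one uncovered edge
and removing edges. -/
def IsExchange (G : SimpleGraph V) (F F' : ι → SimpleGraph V) : Prop :=
  IsMaxForestPacking G F' ∧
    ∃ x y, s(x, y) ∈ uncovered G F ∧ ∀ i, F' i ≤ F i ⊔ edge x y

/-- The graph of all edges left uncovered by some packing obtained from `F` by exchanges. -/
def exchangeGraph (G : SimpleGraph V) (F : ι → SimpleGraph V) : SimpleGraph V :=
  fromEdgeSet {e | ∃ F', Relation.ReflTransGen (IsExchange G) F F' ∧ e ∈ uncovered G F'}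

variable (ι) in
lemma exists_isMaxForestPacking [Finite V] (G : SimpleGraph V) :
    ∃ F : ι → SimpleGraph V, IsMaxForestPacking G F := by
  have hne : {F : ι → SimpleGraph V | IsForestPacking G F}.Nonempty :=
    ⟨fun _ ↦ ⊥, fun _ ↦ isAcyclic_bot, fun _ ↦ bot_le, by simp⟩
  obtain ⟨F, hF, hmax⟩ := Set.exists_max_image _
    (fun F : ι → SimpleGraph V ↦ ∑ i, (F i).edgeSet.ncard) (Set.toFinite _) hne
  exact ⟨F, hF, hmax⟩

lemma sum_ncard_edgeSet_update_add [DecidableEq ι] (F : ι → SimpleGraph V) (i : ι)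
    (H : SimpleGraph V) :
    ∑ j, (Function.update F i H j).edgeSet.ncard + (F i).edgeSet.ncard =
      ∑ j, (F j).edgeSet.ncard + H.edgeSet.ncard := by
  rw [← Finset.add_sum_erase _ _ (Finset.mem_univ i),
    ← Finset.add_sum_erase _ (fun j ↦ (F j).edgeSet.ncard) (Finset.mem_univ i),
    Finset.sum_congr rfl fun j hj ↦ by
      rw [Function.update_of_ne (Finset.ne_of_mem_erase hj)], Function.update_self]
  omega

lemma IsMaxForestPacking.reachable_of_mem_uncovered [Finite V] (hF : IsMaxForestPacking G F)
    {x y : V} (hxy : s(x, y) ∈ uncovered G F) (i : ι) : (F i).Reachable x y := by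
  classical
  by_contra hr
  have := hF.le_of_isForestPacking _ (hF.toIsForestPacking.update hxy
    ((hF.isAcyclic i).sup_edge_of_not_reachable hr) le_rfl)
  have hsum := sum_ncard_edgeSet_update_add F i (F i ⊔ edge x y)
  rw [edgeSet_sup, edgeSet_edge_of_ne (ne_of_mem_uncovered hxy), Set.union_singleton,
    Set.ncard_insert_of_notMem (hxy.2 i)] at hsum
  omega

/-- The edges of the cycle closed in `F i` by an uncovered edge `xy` are uncovered after
an exchange. -/
lemma IsMaxForestPacking.exists_isExchange [Finite V] (hF : IsMaxForestPacking G F)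
    {x y : V} (hxy : s(x, y) ∈ uncovered G F) {i : ι} {p : (F i).Walk x y} (hp : p.IsPath)
    {f : Sym2 V} (hf : f ∈ p.edges) : ∃ F', IsExchange G F F' ∧ f ∈ uncovered G F' := by
  classical
  have hfi : f ∈ (F i).edgeSet := p.edges_subset_edgeSet hf
  have hne : f ≠ s(x, y) := fun h ↦ hxy.2 i (h ▸ hfi)
  have hset : ((F i).deleteEdges {f} ⊔ edge x y).edgeSet =
      insert s(x, y) ((F i).edgeSet \ {f}) := by
    rw [edgeSet_sup, edgeSet_edge_of_ne (ne_of_mem_uncovered hxy), edgeSet_deleteEdges,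
      Set.union_singleton]
  have hle : (F i).deleteEdges {f} ⊔ edge x y ≤ F i ⊔ edge x y :=
    sup_le_sup_right (deleteEdges_le _) _
  have hsum := sum_ncard_edgeSet_update_add F i ((F i).deleteEdges {f} ⊔ edge x y)
  rw [hset, Set.ncard_insert_of_notMem fun h ↦ hxy.2 i h.1,
    Set.ncard_sdiff_singleton_add_one hfi] at hsum
  refine ⟨Function.update F i ((F i).deleteEdges {f} ⊔ edge x y),
    ⟨⟨hF.toIsForestPacking.update hxy ((hF.isAcyclic i).deleteEdges_sup_edge hp hf) hle,
      fun F' hF' ↦ ?_⟩, x, y, hxy, fun j ↦ ?_⟩, edgeSet_mono (hF.le i) hfi, fun j ↦ ?_⟩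
  · have := hF.le_of_isForestPacking F' hF'
    omega
  · rcases eq_or_ne j i with rfl | hj
    · simpa using hle
    · simp [hj]
  · rcases eq_or_ne j i with rfl | hj
    · rw [Function.update_self, hset]
      simp [hne]
    · rw [Function.update_of_ne hj]
      exact Set.disjoint_left.mp (hF.disjoint i j hj.symm) hfi

lemma IsMaxForestPacking.of_reflTransGen (hF : IsMaxForestPacking G F)
    (h : Relation.ReflTransGen (IsExchange G) F F') : IsMaxForestPacking G F' := by
  cases h with
  | refl => exact hF
  | tail _ h => exact h.1

lemma IsMaxForestPacking.reachable_inf_exchangeGraph_of_mem_uncovered [Finite V]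
    (hF : IsMaxForestPacking G F) (h : Relation.ReflTransGen (IsExchange G) F F') {x y : V}
    (hxy : s(x, y) ∈ uncovered G F') (i : ι) :
    (F' i ⊓ exchangeGraph G F).Reachable x y := by
  have hF' := hF.of_reflTransGen h
  obtain ⟨p, hp⟩ := (hF'.reachable_of_mem_uncovered hxy i).exists_isPath
  refine ⟨p.transfer _ fun f hf ↦ ?_⟩
  have hfi : f ∈ (F' i).edgeSet := p.edges_subset_edgeSet hf
  obtain ⟨F'', hF'', hf'⟩ := hF'.exists_isExchange hxy hp hf
  rw [edgeSet_inf, exchangeGraph, edgeSet_fromEdgeSet]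
  exact ⟨hfi, ⟨F'', h.tail hF'', hf'⟩, (F' i).not_isDiag_of_mem_edgeSet hfi⟩

lemma IsMaxForestPacking.reachable_inf_exchangeGraph_of_reflTransGen [Finite V]
    (hF : IsMaxForestPacking G F) (h : Relation.ReflTransGen (IsExchange G) F F') {i : ι}
    {x y : V} (hxy : (F' i ⊓ exchangeGraph G F).Reachable x y) :
    (F i ⊓ exchangeGraph G F).Reachable x y := by
  induction h generalizing x y with
  | refl => exact hxy
  | tail h h' ih =>
    obtain ⟨-, u, v, huv, hle⟩ := h'
    have hr := hF.reachable_inf_exchangeGraph_of_mem_uncovered h huv i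
    refine ih (hxy.of_adj_reachable fun a b hab ↦ ?_)
    rcases hle i hab.1 with hab' | hab'
    · exact Adj.reachable ⟨hab', hab.2⟩
    · rw [edge_adj] at hab'
      rcases hab'.1 with ⟨rfl, rfl⟩ | ⟨rfl, rfl⟩
      · exact hr
      · exact hr.symm

lemma IsMaxForestPacking.reachable_inf_exchangeGraph_iff [Finite V]
    (hF : IsMaxForestPacking G F) (i : ι) {x y : V} :
    (F i ⊓ exchangeGraph G F).Reachable x y ↔ (exchangeGraph G F).Reachable x y := by
  refine ⟨.mono inf_le_right, fun h ↦ h.of_adj_reachable fun a b hab ↦ ?_⟩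
  obtain ⟨⟨F', h, hab'⟩, -⟩ := (fromEdgeSet_adj _).mp hab
  exact hF.reachable_inf_exchangeGraph_of_reflTransGen h
    (hF.reachable_inf_exchangeGraph_of_mem_uncovered h hab' i)

lemma IsMaxForestPacking.ncard_sdiff_exchangeGraph_add [Finite V]
    (hF : IsMaxForestPacking G F) (i : ι) :
    ((F i).edgeSet \ (exchangeGraph G F).edgeSet).ncard + Nat.card (F i).ConnectedComponent =
      Nat.card (exchangeGraph G F).ConnectedComponent := by
  have h₁ := (hF.isAcyclic i).ncard_edgeSet_add_card_connectedComponent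
  have h₂ := ((hF.isAcyclic i).anti
    (inf_le_left (b := exchangeGraph G F))).ncard_edgeSet_add_card_connectedComponent
  have h₃ := Set.ncard_inter_add_ncard_sdiff_eq_ncard (F i).edgeSet (exchangeGraph G F).edgeSet
  have h₄ : Nat.card (F i ⊓ exchangeGraph G F).ConnectedComponent =
      Nat.card (exchangeGraph G F).ConnectedComponent :=
    Nat.card_congr (Quot.congrRight fun _ _ ↦ hF.reachable_inf_exchangeGraph_iff i)
  rw [edgeSet_inf] at h₂
  omega

/-- A maximum forest packing consists of spanning trees as soon as `G` satisfies the
partition condition. -/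
lemma IsMaxForestPacking.isTree [Fintype V] [DecidableEq V] [Nonempty V]
    (hF : IsMaxForestPacking G F)
    (hG : ∀ P : Finpartition (Finset.univ : Finset V),
      Fintype.card ι * (P.parts.card - 1) ≤
        {e ∈ G.edgeSet | ¬∃ p ∈ P.parts, ∀ v ∈ e, v ∈ p}.ncard) (i : ι) :
    (F i).IsTree := by
  classical
  set R := exchangeGraph G F
  let P := Finpartition.ofSetoid R.reachableSetoid
  have hP : ∀ u v, P.part u = P.part v ↔ R.Reachable u v := fun u v ↦ by
    rw [← P.mem_part_iff_part_eq_part (Finset.mem_univ u) (Finset.mem_univ v),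
      Finpartition.mem_part_ofSetoid_iff_rel]
    exact reachable_comm
  have hparts := card_connectedComponent_le_card_parts P fun u v h ↦ (hP u v).mp h
  have hsub : {e ∈ G.edgeSet | ¬∃ p ∈ P.parts, ∀ v ∈ e, v ∈ p} ⊆
      ⋃ i ∈ Finset.univ, (F i).edgeSet \ R.edgeSet := by
    rintro e ⟨he, hcross⟩
    induction e using Sym2.ind with | _ a b
    rw [exists_mem_parts_forall_mem_iff_part_eq, hP] at hcross
    have heR : s(a, b) ∉ R.edgeSet := fun h ↦ hcross (Adj.reachable h)
    have hcov : s(a, b) ∉ uncovered G F := fun h ↦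
      heR ((fromEdgeSet_adj _).mpr ⟨⟨F, .refl, h⟩, Adj.ne (G := G) he⟩)
    obtain ⟨j, hj⟩ : ∃ j, s(a, b) ∈ (F j).edgeSet := by
      by_contra! h
      exact hcov ⟨he, h⟩
    simpa using ⟨⟨j, hj⟩, heR⟩
  have hcross := ((hG P).trans (Set.ncard_le_ncard hsub)).trans
    (Finset.set_ncard_biUnion_le _ _)
  have hpos : ∀ j, 0 < Nat.card (F j).ConnectedComponent := fun j ↦ Nat.card_pos
  have hcard : ∀ j, ((F j).edgeSet \ R.edgeSet).ncard + Nat.card (F j).ConnectedComponent =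
      Nat.card R.ConnectedComponent := hF.ncard_sdiff_exchangeGraph_add
  have hle : ∀ j ∈ Finset.univ, ((F j).edgeSet \ R.edgeSet).ncard ≤
      Nat.card R.ConnectedComponent - 1 := fun j _ ↦ by
    have := hcard j
    have := hpos j
    omega
  refine (hF.isAcyclic i).isTree_of_card_connectedComponent_le_one ?_
  by_contra! hi
  have hlt := Finset.sum_lt_sum hle ⟨i, Finset.mem_univ i, by
    have := hcard i
    omega⟩
  rw [Finset.sum_const, Finset.card_univ, smul_eq_mul] at hlt
  exact absurd (hcross.trans_lt hlt)
    (Nat.mul_le_mul_left _ (Nat.sub_le_sub_right hparts 1)).not_gt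

end ForestPacking

end SimpleGraph

/-- **Nash-Williams, Tutte.**  A finite simple graph `G` on a nonempty vertex set
contains `k` pairwise edge-disjoint spanning trees if and only if for every partition
`P` of the vertex set, the number of edges of `G` whose two endpoints lie in different
parts of `P` is at least `k * (|P| - 1)`. -/
theorem stmt_15 {V : Type} [Fintype V] [DecidableEq V] [Nonempty V]
    (G : SimpleGraph V) (k : ℕ) (hk : 0 < k) :
    (∃ T : Fin k → SimpleGraph V,
        (∀ i, (T i).IsTree ∧ T i ≤ G) ∧
        ∀ i j, i ≠ j → Disjoint (T i).edgeSet (T j).edgeSet) ↔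
      ∀ P : Finpartition (Finset.univ : Finset V),
        k * (P.parts.card - 1) ≤
          {e ∈ G.edgeSet | ¬∃ p ∈ P.parts, ∀ v ∈ e, v ∈ p}.ncard := by
  constructor
  · rintro ⟨T, hT, hdisj⟩ P
    let C : Fin k → Set (Sym2 V) := fun i ↦
      {e ∈ (T i).edgeSet | ¬∃ p ∈ P.parts, ∀ v ∈ e, v ∈ p}
    have hC : ∑ i, (C i).ncard = (⋃ i, C i).ncard := by
      rw [Set.ncard_iUnion_of_finite (fun i ↦ Set.toFinite _) fun i j hij ↦
        (hdisj i j hij).mono (fun _ h ↦ h.1) fun _ h ↦ h.1, finsum_eq_sum_of_fintype]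
    calc k * (P.parts.card - 1) = ∑ _i : Fin k, (P.parts.card - 1) := by simp
      _ ≤ ∑ i, (C i).ncard := Finset.sum_le_sum fun i _ ↦ by
        have := (hT i).1.card_parts_le_ncard_crossing_add_one P
        exact Nat.sub_le_iff_le_add.mpr this
      _ ≤ _ := hC ▸ Set.ncard_le_ncard (Set.iUnion_subset fun i e he ↦
        ⟨SimpleGraph.edgeSet_mono (hT i).2 he.1, he.2⟩)
  · intro h
    obtain ⟨F, hF⟩ := SimpleGraph.exists_isMaxForestPacking (Fin k) G
    exact ⟨F, fun i ↦ ⟨hF.isTree (by simpa using h) i, hF.le i⟩, hF.disjoint⟩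
end
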